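/- arXiv:2103.15397 — 3 statements merged into one kernel-verified Lean document; each statement's English description precedes it below -/
import Mathlib

section
/- Let 𝕜 be a field, H, V finite-dimensional 𝕜-vector spaces, and A : H × V → H × V a linear map with block components A₁ : H → H, A₂ : V → H, A₃ : H → V, A₄ : V → V. Let Û : H → V be a linear map such that A₁ + A₂ ∘ Û : H → H is bijective. Then the image A(Graph(Û)) of the graph of Û under A equals the graph of the linear map (A₃ + A₄ ∘ Û) ∘ (A₁ + A₂ ∘ Û)⁻¹ : H → V. -/
/-- If `A : H × V → H × V` has block components `A₁, A₂, A₃, A₄` and `U : H → V`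
is a linear map with `A₁ + A₂ ∘ U` bijective, then the image of the graph of `U`
under `A` is the graph of `(A₃ + A₄ ∘ U) ∘ (A₁ + A₂ ∘ U)⁻¹`. -/
theorem stmt1 (𝕜 : Type*) [Field 𝕜] (H V : Type*)
    [AddCommGroup H] [Module 𝕜 H] [FiniteDimensional 𝕜 H]
    [AddCommGroup V] [Module 𝕜 V] [FiniteDimensional 𝕜 V]
    (A : (H × V) →ₗ[𝕜] (H × V)) (U : H →ₗ[𝕜] V)
    (A₁ : H →ₗ[𝕜] H) (A₂ : V →ₗ[𝕜] H) (A₃ : H →ₗ[𝕜] V) (A₄ : V →ₗ[𝕜] V)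
    (hA₁ : A₁ = (LinearMap.fst 𝕜 H V) ∘ₗ A ∘ₗ (LinearMap.inl 𝕜 H V))
    (hA₂ : A₂ = (LinearMap.fst 𝕜 H V) ∘ₗ A ∘ₗ (LinearMap.inr 𝕜 H V))
    (hA₃ : A₃ = (LinearMap.snd 𝕜 H V) ∘ₗ A ∘ₗ (LinearMap.inl 𝕜 H V))
    (hA₄ : A₄ = (LinearMap.snd 𝕜 H V) ∘ₗ A ∘ₗ (LinearMap.inr 𝕜 H V))
    (h : Function.Bijective (A₁ + A₂ ∘ₗ U)) :
    (LinearMap.graph U).map A =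
      LinearMap.graph ((A₃ + A₄ ∘ₗ U) ∘ₗ
        ((LinearEquiv.ofBijective (A₁ + A₂ ∘ₗ U) h).symm : H →ₗ[𝕜] H)) := by
  have key : ∀ x : H, A (x, U x) = ((A₁ + A₂ ∘ₗ U) x, (A₃ + A₄ ∘ₗ U) x) := by
    intro x
    have hx : ((x, U x) : H × V) = (x, 0) + (0, U x) := by simp
    rw [hx, map_add]
    subst hA₁ hA₂ hA₃ hA₄
    ext <;> simp
  have hs : ∀ x : H, (LinearEquiv.ofBijective (A₁ + A₂ ∘ₗ U) h).symm
      ((A₁ + A₂ ∘ₗ U) x) = x := fun x =>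
    (LinearEquiv.ofBijective (A₁ + A₂ ∘ₗ U) h).symm_apply_apply x
  ext ⟨p, q⟩
  rw [Submodule.mem_map, LinearMap.mem_graph_iff]
  constructor
  · rintro ⟨⟨x, y⟩, hxy, he⟩
    rw [LinearMap.mem_graph_iff] at hxy
    dsimp only at hxy
    rw [hxy, key, Prod.mk.injEq] at he
    obtain ⟨rfl, rfl⟩ := he
    rw [LinearMap.comp_apply, LinearEquiv.coe_coe, hs]
  · intro hq
    obtain ⟨x, rfl⟩ := h.2 p
    rw [LinearMap.comp_apply, LinearEquiv.coe_coe, hs] at hq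
    exact ⟨(x, U x), by rw [LinearMap.mem_graph_iff], by rw [key, ← hq]⟩
end

section
/- Let 𝕜 be a field, H, V finite-dimensional 𝕜-vector spaces, and A, B : H × V → H × V linear maps with block components (A₁,A₂,A₃,A₄) and (B₁,B₂,B₃,B₄) respectively. Let Û : H → V be linear and set M_A(Û) := (A₃ + A₄ ∘ Û) ∘ (A₁ + A₂ ∘ Û)⁻¹. If A₁ + A₂ ∘ Û is bijective and B₁ + B₂ ∘ M_A(Û) is bijective, then (BA)₁ + (BA)₂ ∘ Û is bijective (where (BA)ᵢ are the block components of the composition B ∘ A) and M_{B∘A}(Û) = M_B(M_A(Û)). -/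
section

variable (𝕜 : Type*) [Field 𝕜] (H V : Type*)
    [AddCommGroup H] [Module 𝕜 H] [AddCommGroup V] [Module 𝕜 V]

/-- First block component `pr_H ∘ A ∘ in_H` of a linear map on `H × V`. -/
def blk₁ (A : (H × V) →ₗ[𝕜] (H × V)) : H →ₗ[𝕜] H :=
  (LinearMap.fst 𝕜 H V) ∘ₗ A ∘ₗ (LinearMap.inl 𝕜 H V)

/-- Second block component `pr_H ∘ A ∘ in_V`. -/
def blk₂ (A : (H × V) →ₗ[𝕜] (H × V)) : V →ₗ[𝕜] H :=
  (LinearMap.fst 𝕜 H V) ∘ₗ A ∘ₗ (LinearMap.inr 𝕜 H V)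

/-- Third block component `pr_V ∘ A ∘ in_H`. -/
def blk₃ (A : (H × V) →ₗ[𝕜] (H × V)) : H →ₗ[𝕜] V :=
  (LinearMap.snd 𝕜 H V) ∘ₗ A ∘ₗ (LinearMap.inl 𝕜 H V)

/-- Fourth block component `pr_V ∘ A ∘ in_V`. -/
def blk₄ (A : (H × V) →ₗ[𝕜] (H × V)) : V →ₗ[𝕜] V :=
  (LinearMap.snd 𝕜 H V) ∘ₗ A ∘ₗ (LinearMap.inr 𝕜 H V)

/-- The graph transform `M_A(U) = (A₃ + A₄ ∘ U) ∘ (A₁ + A₂ ∘ U)⁻¹`. -/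
noncomputable def graphTransform (A : (H × V) →ₗ[𝕜] (H × V)) (U : H →ₗ[𝕜] V)
    (h : Function.Bijective (blk₁ 𝕜 H V A + (blk₂ 𝕜 H V A) ∘ₗ U)) : H →ₗ[𝕜] V :=
  (blk₃ 𝕜 H V A + (blk₄ 𝕜 H V A) ∘ₗ U) ∘ₗ
    ((LinearEquiv.ofBijective (blk₁ 𝕜 H V A + (blk₂ 𝕜 H V A) ∘ₗ U) h).symm : H →ₗ[𝕜] H)

theorem blk_fst_apply (A : (H × V) →ₗ[𝕜] (H × V)) (U : H →ₗ[𝕜] V) (x : H) :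
    (blk₁ 𝕜 H V A + (blk₂ 𝕜 H V A) ∘ₗ U) x = (A (x, U x)).1 := by
  have h : ((x, U x) : H × V) = (x, 0) + (0, U x) := by simp
  rw [h, map_add]
  simp [blk₁, blk₂]

theorem blk_snd_apply (A : (H × V) →ₗ[𝕜] (H × V)) (U : H →ₗ[𝕜] V) (x : H) :
    (blk₃ 𝕜 H V A + (blk₄ 𝕜 H V A) ∘ₗ U) x = (A (x, U x)).2 := by
  have h : ((x, U x) : H × V) = (x, 0) + (0, U x) := by simp
  rw [h, map_add]
  simp [blk₃, blk₄]

theorem graphTransform_fst (A : (H × V) →ₗ[𝕜] (H × V)) (U : H →ₗ[𝕜] V)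
    (h : Function.Bijective (blk₁ 𝕜 H V A + (blk₂ 𝕜 H V A) ∘ₗ U)) (x : H) :
    graphTransform 𝕜 H V A U h (A (x, U x)).1 = (A (x, U x)).2 := by
  have e : (LinearEquiv.ofBijective (blk₁ 𝕜 H V A + (blk₂ 𝕜 H V A) ∘ₗ U) h).symm
      (A (x, U x)).1 = x := by
    rw [LinearEquiv.symm_apply_eq, LinearEquiv.ofBijective_apply, blk_fst_apply]
  rw [graphTransform, LinearMap.comp_apply, LinearEquiv.coe_coe, e, blk_snd_apply]

/-- Cocycle property of the graph transform: if `A₁ + A₂∘U` is bijective and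
`B₁ + B₂∘M_A(U)` is bijective, then `(BA)₁ + (BA)₂∘U` is bijective and
`M_{B∘A}(U) = M_B(M_A(U))`. -/
theorem stmt2 [FiniteDimensional 𝕜 H] [FiniteDimensional 𝕜 V]
    (A B : (H × V) →ₗ[𝕜] (H × V)) (U : H →ₗ[𝕜] V)
    (hA : Function.Bijective (blk₁ 𝕜 H V A + (blk₂ 𝕜 H V A) ∘ₗ U))
    (hB : Function.Bijective
      (blk₁ 𝕜 H V B + (blk₂ 𝕜 H V B) ∘ₗ graphTransform 𝕜 H V A U hA)) :
    ∃ hBA : Function.Bijective (blk₁ 𝕜 H V (B ∘ₗ A) + (blk₂ 𝕜 H V (B ∘ₗ A)) ∘ₗ U),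
      graphTransform 𝕜 H V (B ∘ₗ A) U hBA =
        graphTransform 𝕜 H V B (graphTransform 𝕜 H V A U hA) hB := by
  have key : ∀ x, (((A (x, U x)).1, graphTransform 𝕜 H V A U hA (A (x, U x)).1) : H × V)
      = A (x, U x) := fun x => by rw [graphTransform_fst]
  have hc : ⇑(blk₁ 𝕜 H V (B ∘ₗ A) + (blk₂ 𝕜 H V (B ∘ₗ A)) ∘ₗ U) =
      ⇑(blk₁ 𝕜 H V B + (blk₂ 𝕜 H V B) ∘ₗ graphTransform 𝕜 H V A U hA) ∘
      ⇑(blk₁ 𝕜 H V A + (blk₂ 𝕜 H V A) ∘ₗ U) := by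
    funext x
    rw [Function.comp_apply, blk_fst_apply, blk_fst_apply, blk_fst_apply, key,
      LinearMap.comp_apply]
  have hBA : Function.Bijective (blk₁ 𝕜 H V (B ∘ₗ A) + (blk₂ 𝕜 H V (B ∘ₗ A)) ∘ₗ U) := by
    rw [hc]
    exact hB.comp hA
  refine ⟨hBA, ?_⟩
  ext y
  obtain ⟨x, rfl⟩ := hBA.surjective y
  have h2 := graphTransform_fst 𝕜 H V B _ hB (A (x, U x)).1
  rw [key] at h2
  rw [blk_fst_apply, graphTransform_fst, LinearMap.comp_apply, h2]

end
end

section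
/- Let E be a finite-dimensional real normed vector space, φ : ℝ → E → E a flow (φ_0 = id, φ_{s+t} = φ_s ∘ φ_t), a : E → ℝ a function, and T > 0. Fix x ∈ E and assume t ↦ a(φ_t(x)) is continuous on ℝ. Define b(y) = (1/T) ∫_0^T (T − t) a(φ_t(y)) dt. Then the function s ↦ b(φ_s(x)) is differentiable at s = 0 with derivative (1/T) ∫_0^T a(φ_t(x)) dt − a(x). -/
open intervalIntegral

/-- Derivative along the flow of the weighted flow-average
`b(y) = (1/T) ∫_0^T (T − t) a(φ_t(y)) dt`: the function `s ↦ b(φ_s(x))` is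
differentiable at `s = 0` with derivative `(1/T) ∫_0^T a(φ_t(x)) dt − a(x)`. -/
theorem stmt7 (E : Type*) [NormedAddCommGroup E] [NormedSpace ℝ E]
    [FiniteDimensional ℝ E]
    (φ : ℝ → E → E) (hφ0 : φ 0 = id) (hφ : ∀ s t : ℝ, φ (s + t) = φ s ∘ φ t)
    (a : E → ℝ) (T : ℝ) (hT : 0 < T)
    (x : E) (hcont : Continuous fun t : ℝ => a (φ t x)) :
    HasDerivAt
      (fun s : ℝ => (1 / T) * ∫ t in (0:ℝ)..T, (T - t) * a (φ t (φ s x)))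
      ((1 / T) * (∫ t in (0:ℝ)..T, a (φ t x)) - a x) 0 := by
  obtain ⟨g, hg⟩ : ∃ g : ℝ → ℝ, g = fun t => a (φ t x) := ⟨_, rfl⟩
  have hgc : Continuous g := by rw [hg]; exact hcont
  have hkc : Continuous (fun u : ℝ => u * g u) := by fun_prop
  have hgs : ∀ s t, a (φ t (φ s x)) = g (t + s) := by
    intro s t
    simp [hg, hφ]
  have hg0 : a x = g 0 := by simp [hg, hφ0]
  have hgt : ∀ t, a (φ t x) = g t := by intro t; simp [hg]
  simp only [hgs, hg0, hgt]
  have hG : ∀ u, HasDerivAt (fun y => ∫ t in (0:ℝ)..y, g t) (g u) u := fun u =>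
    integral_hasDerivAt_right (hgc.intervalIntegrable _ _)
      (hgc.stronglyMeasurableAtFilter _ _) hgc.continuousAt
  have hK : ∀ u, HasDerivAt (fun y => ∫ t in (0:ℝ)..y, t * g t) (u * g u) u := fun u =>
    integral_hasDerivAt_right (hkc.intervalIntegrable _ _)
      (hkc.stronglyMeasurableAtFilter _ _) hkc.continuousAt
  have key : ∀ s : ℝ, (∫ t in (0:ℝ)..T, (T - t) * g (t + s)) =
      (T + s) * ((∫ t in (0:ℝ)..(T + s), g t) - ∫ t in (0:ℝ)..s, g t)
      - ((∫ t in (0:ℝ)..(T + s), t * g t) - ∫ t in (0:ℝ)..s, t * g t) := by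
    intro s
    have h1 : (∫ t in (0:ℝ)..T, (T - t) * g (t + s)) =
        ∫ u in s..(T + s), ((T + s) * g u - u * g u) := by
      have := integral_comp_add_right (a := 0) (b := T)
        (fun u => (T + s) * g u - u * g u) s
      rw [zero_add] at this
      rw [← this]
      congr 1
      ext t
      ring
    rw [h1, integral_sub ((hgc.intervalIntegrable _ _).const_mul _)
      (hkc.intervalIntegrable _ _), integral_const_mul,
      integral_interval_sub_left (hgc.intervalIntegrable _ _) (hgc.intervalIntegrable _ _),
      integral_interval_sub_left (hkc.intervalIntegrable _ _) (hkc.intervalIntegrable _ _)]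
  simp only [key]
  have hs : HasDerivAt (fun s : ℝ => T + s) 1 0 := (hasDerivAt_id (0:ℝ)).const_add T
  have hGT : HasDerivAt (fun s => ∫ t in (0:ℝ)..(T + s), g t) (g (T + 0) * 1) 0 :=
    HasDerivAt.comp (0:ℝ) (hG (T + 0)) hs
  have hKT : HasDerivAt (fun s => ∫ t in (0:ℝ)..(T + s), t * g t)
      ((T + 0) * g (T + 0) * 1) 0 :=
    HasDerivAt.comp (0:ℝ) (hK (T + 0)) hs
  have := ((hs.mul (hGT.sub (hG 0))).sub (hKT.sub (hK 0))).const_mul (1 / T)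
  refine this.congr_deriv ?_
  simp
  field_simp
  ring
end
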